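/- arXiv:math/0612401 — 3 statements merged into one kernel-verified Lean document; each statement's English description precedes it below -/
import Mathlib

section
/- Let d ≥ 1 be an integer, ℓ > 0 a constant, and A₁, A₂ : ℝ → ℝ differentiable functions with A₁'(Q) = ℓ and A₂'(Q) = −ℓ for all Q. Let (Q, W, E₁, E₂) : J → ℝ⁴ be differentiable on an interval J containing 0 and solve the averaged equation Q' = W, W' = (2ℓ/d)(E₁/A₁(Q) − E₂/A₂(Q)), E₁' = −(2ℓ/d)·W·E₁/A₁(Q), E₂' = (2ℓ/d)·W·E₂/A₂(Q), with A₁(Q(τ)) > 0 and A₂(Q(τ)) > 0 for all τ ∈ J. Then for each i = 1, 2 the adiabatic invariant τ ↦ E_i(τ)·A_i(Q(τ))^{2/d} is constant on J; in particular E_i(τ) = E_i(0)·(A_i(Q(0))/A_i(Q(τ)))^{2/d}. -/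
/-- If `E' = -p (V' / V) E` along a convex set of times on which `V` is positive, then
`E * V ^ p` takes the same value at any two times. -/
theorem mul_rpow_eq_of_hasDerivAt {J : Set ℝ} (hJ : Convex ℝ J) {E V V' : ℝ → ℝ} {p : ℝ}
    (hE : ∀ τ ∈ J, HasDerivAt E (-p * V' τ * E τ / V τ) τ)
    (hV : ∀ τ ∈ J, HasDerivAt V (V' τ) τ) (hpos : ∀ τ ∈ J, 0 < V τ)
    {s t : ℝ} (hs : s ∈ J) (ht : t ∈ J) :
    E t * V t ^ p = E s * V s ^ p := by
  have hderiv : ∀ τ ∈ J, HasDerivWithinAt (fun x => E x * V x ^ p) 0 J τ := by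
    intro τ hτ
    have hne : V τ ≠ 0 := (hpos τ hτ).ne'
    have h := (hE τ hτ).mul ((hV τ hτ).rpow_const (p := p) (Or.inl hne))
    refine (h.congr_deriv ?_).hasDerivWithinAt
    rw [Real.rpow_sub_one hne]
    ring
  have h := hJ.norm_image_sub_le_of_norm_hasDerivWithin_le (C := 0) hderiv (by simp) hs ht
  rw [zero_mul] at h
  exact sub_eq_zero.mp (norm_le_zero_iff.mp h)

/-- Solving `e * v ^ p = e₀ * v₀ ^ p` for `e`, with `v` and `v₀` positive. -/
theorem eq_mul_div_rpow_of_mul_rpow_eq {e e₀ v v₀ p : ℝ} (hv : 0 < v) (hv₀ : 0 < v₀)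
    (h : e * v ^ p = e₀ * v₀ ^ p) : e = e₀ * (v₀ / v) ^ p := by
  rw [Real.div_rpow hv₀.le hv.le, ← mul_div_assoc, ← h,
    mul_div_cancel_right₀ _ (Real.rpow_pos_of_pos hv p).ne']

/-- Adiabatic invariants of the averaged (Neishtadt–Sinai) piston equation:
along solutions, `E_i · A_i(Q)^{2/d}` is constant; in particular
`E_i(τ) = E_i(0) · (A_i(Q(0))/A_i(Q(τ)))^{2/d}`. -/
theorem averaged_equation_adiabatic_invariant
    (d : ℕ) (hd : 1 ≤ d) (ℓ : ℝ) (hℓ : 0 < ℓ)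
    (A₁ A₂ : ℝ → ℝ)
    (hA₁ : ∀ Q : ℝ, HasDerivAt A₁ ℓ Q) (hA₂ : ∀ Q : ℝ, HasDerivAt A₂ (-ℓ) Q)
    (J : Set ℝ) (hJ : Convex ℝ J) (h0J : (0 : ℝ) ∈ J)
    (Q W E₁ E₂ : ℝ → ℝ)
    (hQ : ∀ τ ∈ J, HasDerivAt Q (W τ) τ)
    (hW : ∀ τ ∈ J, HasDerivAt W
      ((2 * ℓ / d) * (E₁ τ / A₁ (Q τ) - E₂ τ / A₂ (Q τ))) τ)
    (hE₁ : ∀ τ ∈ J, HasDerivAt E₁ (-(2 * ℓ / d) * W τ * E₁ τ / A₁ (Q τ)) τ)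
    (hE₂ : ∀ τ ∈ J, HasDerivAt E₂ ((2 * ℓ / d) * W τ * E₂ τ / A₂ (Q τ)) τ)
    (hA₁pos : ∀ τ ∈ J, 0 < A₁ (Q τ)) (hA₂pos : ∀ τ ∈ J, 0 < A₂ (Q τ)) :
    ∀ τ ∈ J,
      E₁ τ * (A₁ (Q τ)) ^ ((2 : ℝ) / d) = E₁ 0 * (A₁ (Q 0)) ^ ((2 : ℝ) / d) ∧
      E₂ τ * (A₂ (Q τ)) ^ ((2 : ℝ) / d) = E₂ 0 * (A₂ (Q 0)) ^ ((2 : ℝ) / d) ∧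
      E₁ τ = E₁ 0 * (A₁ (Q 0) / A₁ (Q τ)) ^ ((2 : ℝ) / d) ∧
      E₂ τ = E₂ 0 * (A₂ (Q 0) / A₂ (Q τ)) ^ ((2 : ℝ) / d) := by
  intro τ hτ
  have h₁ : E₁ τ * (A₁ (Q τ)) ^ ((2 : ℝ) / d) = E₁ 0 * (A₁ (Q 0)) ^ ((2 : ℝ) / d) :=
    mul_rpow_eq_of_hasDerivAt (V := fun t => A₁ (Q t)) (V' := fun t => ℓ * W t) hJ
      (fun t ht => (hE₁ t ht).congr_deriv (by ring))
      (fun t ht => (hA₁ (Q t)).comp t (hQ t ht)) hA₁pos h0J hτ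
  have h₂ : E₂ τ * (A₂ (Q τ)) ^ ((2 : ℝ) / d) = E₂ 0 * (A₂ (Q 0)) ^ ((2 : ℝ) / d) :=
    mul_rpow_eq_of_hasDerivAt (V := fun t => A₂ (Q t)) (V' := fun t => -ℓ * W t) hJ
      (fun t ht => (hE₂ t ht).congr_deriv (by ring))
      (fun t ht => (hA₂ (Q t)).comp t (hQ t ht)) hA₂pos h0J hτ
  exact ⟨h₁, h₂,
    eq_mul_div_rpow_of_mul_rpow_eq (hA₁pos τ hτ) (hA₁pos 0 h0J) h₁,
    eq_mul_div_rpow_of_mul_rpow_eq (hA₂pos τ hτ) (hA₂pos 0 h0J) h₂⟩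
end

section
/- Let d ≥ 1 be an integer, ℓ > 0 a constant, and A₁, A₂ : ℝ → ℝ differentiable functions with A₁'(Q) = ℓ and A₂'(Q) = −ℓ for all Q. Let (Q, W, E₁, E₂) : J → ℝ⁴ be differentiable on an interval J containing 0 and solve the averaged equation Q' = W, W' = (2ℓ/d)(E₁/A₁(Q) − E₂/A₂(Q)), E₁' = −(2ℓ/d)·W·E₁/A₁(Q), E₂' = (2ℓ/d)·W·E₂/A₂(Q), with A₁(Q(τ)) > 0 and A₂(Q(τ)) > 0 for all τ ∈ J. Then the effective Hamiltonian τ ↦ W(τ)²/2 + E₁(0)·(A₁(Q(0))/A₁(Q(τ)))^{2/d} + E₂(0)·(A₂(Q(0))/A₂(Q(τ)))^{2/d} is constant on J. -/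
/-- A real function with zero derivative at every point of a convex set is constant on it. -/
theorem Convex.eq_of_hasDerivAt_zero {J : Set ℝ} (hJ : Convex ℝ J) {f : ℝ → ℝ}
    (hf : ∀ t ∈ J, HasDerivAt f 0 t) {s t : ℝ} (hs : s ∈ J) (ht : t ∈ J) : f t = f s := by
  have h := hJ.norm_image_sub_le_of_norm_hasDerivWithin_le (C := 0)
    (fun x hx => (hf x hx).hasDerivWithinAt) (fun _ _ => by simp) hs ht
  rw [zero_mul, norm_le_zero_iff] at h
  exact sub_eq_zero.mp h

/-- If `E' = -p (a'/a) E` with `a > 0`, then `E a ^ p` is an adiabatic invariant. -/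
theorem eq_mul_div_rpow_of_hasDerivAt {J : Set ℝ} (hJ : Convex ℝ J) {p : ℝ}
    {a a' E : ℝ → ℝ} (ha : ∀ t ∈ J, HasDerivAt a (a' t) t)
    (hE : ∀ t ∈ J, HasDerivAt E (-(p * a' t * E t / a t)) t)
    (hpos : ∀ t ∈ J, 0 < a t) {s t : ℝ} (hs : s ∈ J) (ht : t ∈ J) :
    E s * (a s / a t) ^ p = E t := by
  have hconst : E t * a t ^ p = E s * a s ^ p := by
    refine hJ.eq_of_hasDerivAt_zero (f := fun t => E t * a t ^ p) (fun u hu => ?_) hs ht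
    have hu0 := hpos u hu
    refine ((hE u hu).mul ((ha u hu).rpow_const (p := p) (Or.inl hu0.ne'))).congr_deriv ?_
    rw [Real.rpow_sub_one hu0.ne']
    field_simp
    ring
  rw [Real.div_rpow (hpos s hs).le (hpos t ht).le, ← mul_div_assoc, ← hconst]
  exact mul_div_cancel_right₀ _ (Real.rpow_pos_of_pos (hpos t ht) p).ne'

/-- Conservation of the effective Hamiltonian
`W²/2 + E₁(0)(A₁(Q(0))/A₁(Q))^{2/d} + E₂(0)(A₂(Q(0))/A₂(Q))^{2/d}`
along solutions of the averaged (Neishtadt–Sinai) piston equation. -/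
theorem averaged_equation_effective_hamiltonian
    (d : ℕ) (hd : 1 ≤ d) (ℓ : ℝ) (hℓ : 0 < ℓ)
    (A₁ A₂ : ℝ → ℝ)
    (hA₁ : ∀ Q : ℝ, HasDerivAt A₁ ℓ Q) (hA₂ : ∀ Q : ℝ, HasDerivAt A₂ (-ℓ) Q)
    (J : Set ℝ) (hJ : Convex ℝ J) (h0J : (0 : ℝ) ∈ J)
    (Q W E₁ E₂ : ℝ → ℝ)
    (hQ : ∀ τ ∈ J, HasDerivAt Q (W τ) τ)
    (hW : ∀ τ ∈ J, HasDerivAt W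
      ((2 * ℓ / d) * (E₁ τ / A₁ (Q τ) - E₂ τ / A₂ (Q τ))) τ)
    (hE₁ : ∀ τ ∈ J, HasDerivAt E₁ (-(2 * ℓ / d) * W τ * E₁ τ / A₁ (Q τ)) τ)
    (hE₂ : ∀ τ ∈ J, HasDerivAt E₂ ((2 * ℓ / d) * W τ * E₂ τ / A₂ (Q τ)) τ)
    (hA₁pos : ∀ τ ∈ J, 0 < A₁ (Q τ)) (hA₂pos : ∀ τ ∈ J, 0 < A₂ (Q τ)) :
    ∀ τ ∈ J,
      W τ ^ 2 / 2 + E₁ 0 * (A₁ (Q 0) / A₁ (Q τ)) ^ ((2 : ℝ) / d)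
        + E₂ 0 * (A₂ (Q 0) / A₂ (Q τ)) ^ ((2 : ℝ) / d)
      = W 0 ^ 2 / 2 + E₁ 0 * (A₁ (Q 0) / A₁ (Q 0)) ^ ((2 : ℝ) / d)
        + E₂ 0 * (A₂ (Q 0) / A₂ (Q 0)) ^ ((2 : ℝ) / d) := by
  intro τ hτ
  have e₁ : ∀ t ∈ J, E₁ 0 * (A₁ (Q 0) / A₁ (Q t)) ^ ((2 : ℝ) / d) = E₁ t := fun t ht =>
    eq_mul_div_rpow_of_hasDerivAt hJ (a := fun t => A₁ (Q t))
      (fun u hu => (hA₁ (Q u)).comp u (hQ u hu))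
      (fun u hu => (hE₁ u hu).congr_deriv (by ring)) hA₁pos h0J ht
  have e₂ : ∀ t ∈ J, E₂ 0 * (A₂ (Q 0) / A₂ (Q t)) ^ ((2 : ℝ) / d) = E₂ t := fun t ht =>
    eq_mul_div_rpow_of_hasDerivAt hJ (a := fun t => A₂ (Q t))
      (fun u hu => (hA₂ (Q u)).comp u (hQ u hu))
      (fun u hu => (hE₂ u hu).congr_deriv (by ring)) hA₂pos h0J ht
  rw [e₁ τ hτ, e₂ τ hτ, e₁ 0 h0J, e₂ 0 h0J]
  refine hJ.eq_of_hasDerivAt_zero (f := fun t => W t ^ 2 / 2 + E₁ t + E₂ t)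
    (fun u hu => ?_) h0J hτ
  refine (((((hW u hu).pow 2).div_const 2).add (hE₁ u hu)).add (hE₂ u hu)).congr_deriv ?_
  push_cast
  ring
end

section
/- Let (X, Σ, μ) be a probability space and (T_t)_{t∈ℝ} a flow of invertible measure-preserving transformations of X (T_0 = id, T_{t+s} = T_t ∘ T_s, each T_t is a measurable bijection with measurable inverse T_{−t}, and μ(T_t(A)) = μ(A) for every measurable A and every t). Let B be a measurable set and assume that for every compact interval I ⊂ ℝ the set ⋃_{t∈I} T_t(B) is measurable. Then for all S > 0 and γ > 0: μ(⋃_{0≤t≤S} T_{−t}(B)) ≤ μ(B) + (S/γ + 1)·μ((⋃_{0≤t≤γ} T_t(B)) \ B). -/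
open MeasureTheory

/-- Each time step `γ` adds to the forward sweep of `B` at most the measure of the set of points
that enter `B` within time `γ` without starting in `B`. -/
theorem measure_flow_sweep_nat_mul_le
    {X : Type*} [MeasurableSpace X] (μ : Measure X) (T : ℝ → X → X)
    (hT0 : T 0 = id)
    (hTadd : ∀ t s : ℝ, T (t + s) = T t ∘ T s)
    (hTpres : ∀ (t : ℝ) (A : Set X), MeasurableSet A → μ (T t '' A) = μ A)
    (B : Set X) (γ : ℝ) (hγ : 0 < γ)
    (hE : MeasurableSet ((⋃ t ∈ Set.Icc (0 : ℝ) γ, T t '' B) \ B)) (n : ℕ) :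
    μ (⋃ t ∈ Set.Icc (0 : ℝ) (n * γ), T t '' B) ≤
      μ B + n * μ ((⋃ t ∈ Set.Icc (0 : ℝ) γ, T t '' B) \ B) := by
  induction n with
  | zero => simp [hT0]
  | succ n ih =>
    set E := (⋃ t ∈ Set.Icc (0 : ℝ) γ, T t '' B) \ B
    have hn : (0 : ℝ) ≤ n * γ := by positivity
    have hsub : (⋃ t ∈ Set.Icc (0 : ℝ) ((n + 1 : ℕ) * γ), T t '' B) ⊆
        (⋃ t ∈ Set.Icc (0 : ℝ) (n * γ), T t '' B) ∪ T (n * γ) '' E := by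
      intro x hx
      simp only [Set.mem_iUnion, Set.mem_image, exists_prop] at hx
      obtain ⟨t, ⟨ht0, ht⟩, b, hb, rfl⟩ := hx
      push_cast at ht
      rcases le_or_gt t (n * γ) with h | h
      · exact Or.inl (Set.mem_biUnion ⟨ht0, h⟩ ⟨b, hb, rfl⟩)
      · have hsplit : T t b = T (n * γ) (T (t - n * γ) b) := by
          rw [← Function.comp_apply (f := T (n * γ)), ← hTadd, add_sub_cancel]
        by_cases hB : T (t - n * γ) b ∈ B
        · exact Or.inl (Set.mem_biUnion ⟨hn, le_rfl⟩ ⟨_, hB, hsplit.symm⟩)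
        · refine Or.inr ⟨_, ⟨Set.mem_biUnion ⟨?_, ?_⟩ ⟨b, hb, rfl⟩, hB⟩, hsplit.symm⟩ <;>
            linarith
    calc _ ≤ _ := measure_mono hsub
      _ ≤ _ := measure_union_le _ _
      _ ≤ (μ B + n * μ E) + μ E := add_le_add ih (hTpres _ _ hE).le
      _ = μ B + (n + 1 : ℕ) * μ E := by push_cast; ring

/-- The sweep estimate: for a measure-preserving flow `(T_t)` on a probability
space, the measure of the set of points whose forward orbit up to time `S`
visits `B` is at most `μ(B) + (S/γ + 1)·μ((⋃_{0≤t≤γ} T_t(B)) \ B)`. -/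
theorem flow_sweep_estimate
    {X : Type*} [MeasurableSpace X] (μ : Measure X) [IsProbabilityMeasure μ]
    (T : ℝ → X → X)
    (hT0 : T 0 = id)
    (hTadd : ∀ t s : ℝ, T (t + s) = T t ∘ T s)
    (hTmeas : ∀ t : ℝ, Measurable (T t))
    (hTbij : ∀ t : ℝ, Function.Bijective (T t))
    (hTpres : ∀ (t : ℝ) (A : Set X), MeasurableSet A → μ (T t '' A) = μ A)
    (B : Set X) (hB : MeasurableSet B)
    (hU : ∀ I : Set ℝ, IsCompact I → MeasurableSet (⋃ t ∈ I, T t '' B))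
    (S γ : ℝ) (hS : 0 < S) (hγ : 0 < γ) :
    μ (⋃ t ∈ Set.Icc (0 : ℝ) S, T (-t) '' B) ≤
      μ B + (ENNReal.ofReal (S / γ) + 1) * μ ((⋃ t ∈ Set.Icc (0 : ℝ) γ, T t '' B) \ B) := by
  have hE := (hU _ (isCompact_Icc (a := (0 : ℝ)) (b := γ))).diff hB
  set N := ⌈S / γ⌉₊
  have hSN : S ≤ N * γ := (div_le_iff₀ hγ).1 (Nat.le_ceil _)
  have hN : (N : ENNReal) ≤ ENNReal.ofReal (S / γ) + 1 := by
    rw [← ENNReal.ofReal_natCast, ← ENNReal.ofReal_one,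
      ← ENNReal.ofReal_add (by positivity) zero_le_one]
    exact ENNReal.ofReal_le_ofReal (Nat.ceil_lt_add_one (by positivity)).le
  have hsub : (⋃ t ∈ Set.Icc (0 : ℝ) S, T (-t) '' B) ⊆
      T (-S) '' (⋃ t ∈ Set.Icc (0 : ℝ) (N * γ), T t '' B) := by
    intro x hx
    simp only [Set.mem_iUnion, Set.mem_image, exists_prop] at hx
    obtain ⟨t, ⟨ht0, ht⟩, b, hb, rfl⟩ := hx
    refine ⟨T (S - t) b, Set.mem_biUnion ⟨by linarith, by linarith⟩ ⟨b, hb, rfl⟩, ?_⟩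
    rw [← Function.comp_apply (f := T (-S)), ← hTadd]
    congr 1
    ring_nf
  calc _ ≤ _ := measure_mono hsub
    _ = _ := hTpres _ _ (hU _ isCompact_Icc)
    _ ≤ _ := measure_flow_sweep_nat_mul_le μ T hT0 hTadd hTpres B γ hγ hE N
    _ ≤ _ := by gcongr
end
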